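/- Let J₆(x,y) = −1 + 2·Re(j₆(x+iy, x−iy)) with j₆(u,v) = (2−8b)u³ − b·u⁶ + 6uv + 6b·u⁴v − (9/2)u²v², b = exp(−iπ/3), and let f : ℝ³ → ℝ be f(x,y,z) = J₆(x,y) + (z−3)⁴z²/16. Then the singular locus {p ∈ ℝ³ : f(p) = 0 and ∇f(p) = 0} consists of exactly 37 points; at exactly 22 of these points the Hessian matrix of f is invertible (these are the 22 A₁-singularities of the sextic surface f = 0), and at exactly 15 of these points the Hessian matrix of f has rank 2 (these are the 15 A₃-singularities). -/

import Mathlib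

noncomputable section

/-- `bC = exp(-iπ/3)`. -/
def bC : ℂ := Complex.exp (-((Real.pi : ℂ) / 3) * Complex.I)

/-- The polynomial `j6(u,v)`. -/
def j6 (u v : ℂ) : ℂ := (2 - 8*bC)*u^3 - bC*u^6 + 6*u*v + 6*bC*u^4*v - (9/2)*u^2*v^2

/-- The real folding-type polynomial `J6(x,y) = -1 + 2 Re(j6(x+iy, x-iy))`. -/
def J6R (x y : ℝ) : ℝ :=
  -1 + 2 * (j6 ((x : ℂ) + (y : ℂ) * Complex.I) ((x : ℂ) - (y : ℂ) * Complex.I)).re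

/-- Partial derivative of `f` in the `i`-th coordinate direction. -/
def pd {n : ℕ} (i : Fin n) (f : (Fin n → ℝ) → ℝ) (x : Fin n → ℝ) : ℝ :=
  deriv (fun t => f (Function.update x i t)) (x i)

/-- Hessian matrix of `f` at `x`. -/
def hessian {n : ℕ} (f : (Fin n → ℝ) → ℝ) (x : Fin n → ℝ) : Matrix (Fin n) (Fin n) ℝ :=
  Matrix.of fun i j => pd i (pd j f) x

/-- Real part of `u³`. -/
def PP (x y : ℝ) : ℝ := x^3 - 3*x*y^2
/-- Imaginary part of `u³`. -/
def QQ (x y : ℝ) : ℝ := 3*x^2*y - y^3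
/-- `|u|²`. -/
def RR (x y : ℝ) : ℝ := x^2 + y^2

/-- `J₆` through the invariants. -/
def JJ (s p q r : ℝ) : ℝ :=
  -1 - 4*p - 8*s*q - (p^2 - q^2) - 2*s*p*q + 6*r*(p + s*q) + 12*r - 9*r^2
def Jp (s p q r : ℝ) : ℝ := -4 - 2*p - 2*s*q + 6*r
def Jq (s p q r : ℝ) : ℝ := -8*s + 2*q - 2*s*p + 6*s*r
def Jr (s p q r : ℝ) : ℝ := 6*(p + s*q) + 12 - 18*r

/-- chain rule -/
def Jd (s p q r p' q' r' : ℝ) : ℝ := Jp s p q r * p' + Jq s p q r * q' + Jr s p q r * r'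
def Jdd (s p q r p1 q1 r1 p2 q2 r2 p12 q12 r12 : ℝ) : ℝ :=
  Jd s p q r p12 q12 r12 + (-2*p2 - 2*s*q2 + 6*r2) * p1 + (2*q2 - 2*s*p2 + 6*s*r2) * q1
    + (6*(p2 + s*q2) - 18*r2) * r1

def Jx (s x y : ℝ) : ℝ := Jd s (PP x y) (QQ x y) (RR x y) (3*x^2-3*y^2) (6*x*y) (2*x)
def Jy (s x y : ℝ) : ℝ := Jd s (PP x y) (QQ x y) (RR x y) (-(6*x*y)) (3*x^2-3*y^2) (2*y)
def Jxx (s x y : ℝ) : ℝ := Jdd s (PP x y) (QQ x y) (RR x y)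
  (3*x^2-3*y^2) (6*x*y) (2*x) (3*x^2-3*y^2) (6*x*y) (2*x) (6*x) (6*y) 2
def Jxy (s x y : ℝ) : ℝ := Jdd s (PP x y) (QQ x y) (RR x y)
  (3*x^2-3*y^2) (6*x*y) (2*x) (-(6*x*y)) (3*x^2-3*y^2) (2*y) (-(6*y)) (6*x) 0
def Jyy (s x y : ℝ) : ℝ := Jdd s (PP x y) (QQ x y) (RR x y)
  (-(6*x*y)) (3*x^2-3*y^2) (2*y) (-(6*x*y)) (3*x^2-3*y^2) (2*y) (-(6*x)) (-(6*y)) 2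

lemma Jxy_symm (s x y : ℝ) : Jdd s (PP x y) (QQ x y) (RR x y)
  (-(6*x*y)) (3*x^2-3*y^2) (2*y) (3*x^2-3*y^2) (6*x*y) (2*x) (-(6*y)) (6*x) 0 = Jxy s x y := by
  unfold Jxy Jdd; ring

lemma hasDerivAt_JJ (s : ℝ) {P Q R : ℝ → ℝ} {P' Q' R' t : ℝ} (hP : HasDerivAt P P' t)
    (hQ : HasDerivAt Q Q' t) (hR : HasDerivAt R R' t) :
    HasDerivAt (fun t => JJ s (P t) (Q t) (R t)) (Jd s (P t) (Q t) (R t) P' Q' R') t := by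
  have h1 := (((((((hP.const_mul 4).const_sub (-1)).fun_sub (hQ.const_mul (8*s))).fun_sub
    ((hP.fun_pow 2).fun_sub (hQ.fun_pow 2))).fun_sub ((hP.const_mul (2*s)).fun_mul hQ)).fun_add
    ((hR.const_mul 6).fun_mul (hP.fun_add (hQ.const_mul s)))).fun_add (hR.const_mul 12)).fun_sub
    ((hR.fun_pow 2).const_mul 9)
  refine h1.congr_deriv ?_
  simp only [Jd, Jp, Jq, Jr]; push_cast; ring

lemma hasDerivAt_Jd (s : ℝ) {P Q R P1 Q1 R1 : ℝ → ℝ} {P' Q' R' P1' Q1' R1' t : ℝ}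
    (hP : HasDerivAt P P' t) (hQ : HasDerivAt Q Q' t) (hR : HasDerivAt R R' t)
    (hP1 : HasDerivAt P1 P1' t) (hQ1 : HasDerivAt Q1 Q1' t) (hR1 : HasDerivAt R1 R1' t) :
    HasDerivAt (fun t => Jd s (P t) (Q t) (R t) (P1 t) (Q1 t) (R1 t))
      (Jdd s (P t) (Q t) (R t) (P1 t) (Q1 t) (R1 t) P' Q' R' P1' Q1' R1') t := by
  have hp := (((hP.const_mul 2).const_sub (-4)).fun_sub (hQ.const_mul (2*s))).fun_add (hR.const_mul 6)
  have hq := (((hQ.const_mul 2).const_add (-8*s)).fun_sub (hP.const_mul (2*s))).fun_add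
    (hR.const_mul (6*s))
  have hr := (((hP.fun_add (hQ.const_mul s)).const_mul 6).add_const 12).fun_sub (hR.const_mul 18)
  have h1 := ((hp.fun_mul hP1).fun_add (hq.fun_mul hQ1)).fun_add (hr.fun_mul hR1)
  refine h1.congr_deriv ?_
  simp only [Jdd, Jd, Jp, Jq, Jr]; ring

lemma dPx (x y : ℝ) : HasDerivAt (fun t => PP t y) (3*x^2-3*y^2) x := by
  refine (((hasDerivAt_id' x).fun_pow 3).fun_sub
    (((hasDerivAt_id' x).const_mul 3).mul_const (y^2))).congr_deriv ?_
  push_cast; ring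
lemma dPy (x y : ℝ) : HasDerivAt (fun t => PP x t) (-(6*x*y)) y := by
  refine ((((hasDerivAt_id' y).fun_pow 2).const_mul (3*x)).const_sub (x^3)).congr_deriv ?_
  push_cast; ring
lemma dQx (x y : ℝ) : HasDerivAt (fun t => QQ t y) (6*x*y) x := by
  refine (((((hasDerivAt_id' x).fun_pow 2).const_mul 3).mul_const y).sub_const (y^3)).congr_deriv ?_
  push_cast; ring
lemma dQy (x y : ℝ) : HasDerivAt (fun t => QQ x t) (3*x^2-3*y^2) y := by
  refine (((hasDerivAt_id' y).const_mul (3*x^2)).fun_sub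
    ((hasDerivAt_id' y).fun_pow 3)).congr_deriv ?_
  push_cast; ring
lemma dRx (x y : ℝ) : HasDerivAt (fun t => RR t y) (2*x) x := by
  refine (((hasDerivAt_id' x).fun_pow 2).add_const (y^2)).congr_deriv ?_
  push_cast; ring
lemma dRy (x y : ℝ) : HasDerivAt (fun t => RR x t) (2*y) y := by
  refine (((hasDerivAt_id' y).fun_pow 2).const_add (x^2)).congr_deriv ?_
  push_cast; ring
lemma dsqx (x y : ℝ) : HasDerivAt (fun t => 3*t^2-3*y^2) (6*x) x := by
  refine ((((hasDerivAt_id' x).fun_pow 2).const_mul 3).sub_const (3*y^2)).congr_deriv ?_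
  push_cast; ring
lemma dsqy (x y : ℝ) : HasDerivAt (fun t => 3*x^2-3*t^2) (-(6*y)) y := by
  refine ((((hasDerivAt_id' y).fun_pow 2).const_mul 3).const_sub (3*x^2)).congr_deriv ?_
  push_cast; ring
lemma dxyx (x y : ℝ) : HasDerivAt (fun t => 6*t*y) (6*y) x := by
  refine (((hasDerivAt_id' x).const_mul 6).mul_const y).congr_deriv ?_
  ring
lemma dxyy (x y : ℝ) : HasDerivAt (fun t => 6*x*t) (6*x) y := by
  refine ((hasDerivAt_id' y).const_mul (6*x)).congr_deriv ?_
  ring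
lemma d2 (x : ℝ) : HasDerivAt (fun t => 2*t) 2 x := by
  refine ((hasDerivAt_id' x).const_mul 2).congr_deriv ?_
  ring

/-- the `z`-part and its derivatives -/
def gg (z : ℝ) : ℝ := (z-3)^4*z^2/16
def gz (z : ℝ) : ℝ := (z-3)^3*z*(6*z-6)/16
def gzz (z : ℝ) : ℝ := ((3*(z-3)^2*z+(z-3)^3)*(6*z-6)+(z-3)^3*z*6)/16
lemma dgg (z : ℝ) : HasDerivAt gg (gz z) z := by
  refine (((((hasDerivAt_id' z).sub_const 3).fun_pow 4).fun_mul
    ((hasDerivAt_id' z).fun_pow 2)).div_const 16).congr_deriv ?_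
  unfold gz; push_cast; ring
lemma dgz (z : ℝ) : HasDerivAt gz (gzz z) z := by
  refine ((((((hasDerivAt_id' z).sub_const 3).fun_pow 3).fun_mul
    (hasDerivAt_id' z)).fun_mul (((hasDerivAt_id' z).const_mul 6).sub_const 6)).div_const 16).congr_deriv ?_
  unfold gzz; push_cast; ring

lemma pd_eq {f : (Fin 3 → ℝ) → ℝ} {p : Fin 3 → ℝ} {i : Fin 3} {φ : ℝ → ℝ} {d : ℝ}
    (h : ∀ t, f (Function.update p i t) = φ t) (hd : HasDerivAt φ d (p i)) : pd i f p = d := by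
  unfold pd
  rw [funext h]; exact hd.deriv

def FF (s : ℝ) (p : Fin 3 → ℝ) : ℝ :=
  JJ s (PP (p 0) (p 1)) (QQ (p 0) (p 1)) (RR (p 0) (p 1)) + gg (p 2)

lemma pd0 (s : ℝ) : pd 0 (FF s) = fun p => Jx s (p 0) (p 1) := by
  funext p
  exact pd_eq (φ := fun t => JJ s (PP t (p 1)) (QQ t (p 1)) (RR t (p 1)) + gg (p 2))
    (fun t => by simp [FF])
    ((hasDerivAt_JJ s (dPx _ _) (dQx _ _) (dRx _ _)).add_const _)
lemma pd1 (s : ℝ) : pd 1 (FF s) = fun p => Jy s (p 0) (p 1) := by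
  funext p
  exact pd_eq (φ := fun t => JJ s (PP (p 0) t) (QQ (p 0) t) (RR (p 0) t) + gg (p 2))
    (fun t => by simp [FF])
    ((hasDerivAt_JJ s (dPy _ _) (dQy _ _) (dRy _ _)).add_const _)
lemma pd2 (s : ℝ) : pd 2 (FF s) = fun p => gz (p 2) := by
  funext p
  exact pd_eq (φ := fun t => JJ s (PP (p 0) (p 1)) (QQ (p 0) (p 1)) (RR (p 0) (p 1)) + gg t)
    (fun t => by simp [FF]) ((dgg _).const_add _)

lemma hess (s : ℝ) (p : Fin 3 → ℝ) : hessian (FF s) p =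
    !![Jxx s (p 0) (p 1), Jxy s (p 0) (p 1), 0; Jxy s (p 0) (p 1), Jyy s (p 0) (p 1), 0;
      0, 0, gzz (p 2)] := by
  have h00 : pd 0 (pd 0 (FF s)) p = Jxx s (p 0) (p 1) := by
    rw [pd0]
    exact pd_eq (φ := fun t => Jx s t (p 1)) (fun t => by simp)
      (hasDerivAt_Jd s (dPx _ _) (dQx _ _) (dRx _ _) (dsqx _ _) (dxyx _ _) (d2 _))
  have h10 : pd 1 (pd 0 (FF s)) p = Jxy s (p 0) (p 1) := by
    rw [pd0]
    exact pd_eq (φ := fun t => Jx s (p 0) t) (fun t => by simp)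
      (hasDerivAt_Jd s (dPy _ _) (dQy _ _) (dRy _ _) (dsqy _ _) (dxyy _ _) (hasDerivAt_const _ _))
  have h01 : pd 0 (pd 1 (FF s)) p = Jxy s (p 0) (p 1) := by
    rw [pd1, ← Jxy_symm]
    exact pd_eq (φ := fun t => Jy s t (p 1)) (fun t => by simp)
      (hasDerivAt_Jd s (dPx _ _) (dQx _ _) (dRx _ _) (dxyx _ _).fun_neg (dsqx _ _)
        (hasDerivAt_const _ _))
  have h11 : pd 1 (pd 1 (FF s)) p = Jyy s (p 0) (p 1) := by
    rw [pd1]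
    exact pd_eq (φ := fun t => Jy s (p 0) t) (fun t => by simp)
      (hasDerivAt_Jd s (dPy _ _) (dQy _ _) (dRy _ _) (dxyy _ _).fun_neg (dsqy _ _) (d2 _))
  have h20 : pd 2 (pd 0 (FF s)) p = 0 := by
    rw [pd0]
    exact pd_eq (φ := fun _ => Jx s (p 0) (p 1)) (fun t => by simp) (hasDerivAt_const _ _)
  have h21 : pd 2 (pd 1 (FF s)) p = 0 := by
    rw [pd1]
    exact pd_eq (φ := fun _ => Jy s (p 0) (p 1)) (fun t => by simp) (hasDerivAt_const _ _)
  have h02 : pd 0 (pd 2 (FF s)) p = 0 := by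
    rw [pd2]
    exact pd_eq (φ := fun _ => gz (p 2)) (fun t => by simp) (hasDerivAt_const _ _)
  have h12 : pd 1 (pd 2 (FF s)) p = 0 := by
    rw [pd2]
    exact pd_eq (φ := fun _ => gz (p 2)) (fun t => by simp) (hasDerivAt_const _ _)
  have h22 : pd 2 (pd 2 (FF s)) p = gzz (p 2) := by
    rw [pd2]
    exact pd_eq (φ := gz) (fun t => by simp) (dgz _)
  ext i j
  fin_cases i <;> fin_cases j <;> simp [hessian, *]

lemma det_hess (a b d g : ℝ) : (!![a, b, 0; b, d, 0; 0, 0, g] : Matrix (Fin 3) (Fin 3) ℝ).det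
    = (a*d-b^2)*g := by
  rw [Matrix.det_fin_three]; simp; ring

lemma rank_hess (a b d : ℝ) (h : a*d-b^2 ≠ 0) :
    (!![a, b, 0; b, d, 0; 0, 0, 0] : Matrix (Fin 3) (Fin 3) ℝ).rank = 2 := by
  apply le_antisymm
  · have : (!![a, b, 0; b, d, 0; 0, 0, 0] : Matrix (Fin 3) (Fin 3) ℝ)
      = (!![a, b; b, d; 0, 0] : Matrix (Fin 3) (Fin 2) ℝ) * (!![1, 0, 0; 0, 1, 0] : Matrix (Fin 2) (Fin 3) ℝ) := by
      ext i j; fin_cases i <;> fin_cases j <;> simp [Matrix.mul_apply, Fin.sum_univ_two]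
    rw [this]
    refine (Matrix.rank_mul_le_left _ _).trans ?_
    simpa using Matrix.rank_le_width (!![a, b; b, d; 0, 0] : Matrix (Fin 3) (Fin 2) ℝ)
  · have h2 : (!![a, b; b, d] : Matrix (Fin 2) (Fin 2) ℝ).rank = 2 := by
      have : IsUnit (!![a, b; b, d] : Matrix (Fin 2) (Fin 2) ℝ) := by
        rw [Matrix.isUnit_iff_isUnit_det, isUnit_iff_ne_zero, Matrix.det_fin_two_of]
        intro h'; apply h; linarith
      simpa using Matrix.rank_of_isUnit _ this
    have : (!![a, b; b, d] : Matrix (Fin 2) (Fin 2) ℝ) =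
      ((!![1, 0, 0; 0, 1, 0] : Matrix (Fin 2) (Fin 3) ℝ) * !![a, b, 0; b, d, 0; 0, 0, 0])
        * (!![1, 0; 0, 1; 0, 0] : Matrix (Fin 3) (Fin 2) ℝ) := by
      ext i j; fin_cases i <;> fin_cases j <;> simp [Matrix.mul_apply, Fin.sum_univ_three]
    rw [this] at h2
    refine h2.symm.le.trans ?_
    exact (Matrix.rank_mul_le_left _ _).trans (Matrix.rank_mul_le_right _ _)

lemma bC_eq : bC = ⟨1/2, -(√3)/2⟩ := by
  have h : -((Real.pi : ℂ) / 3) * Complex.I = ((-(Real.pi/3) : ℝ) : ℂ) * Complex.I := by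
    push_cast; ring
  apply Complex.ext
  · rw [bC, h, Complex.exp_ofReal_mul_I_re, Real.cos_neg, Real.cos_pi_div_three]
  · rw [bC, h, Complex.exp_ofReal_mul_I_im, Real.sin_neg, Real.sin_pi_div_three]; ring

lemma J6R_eq (x y : ℝ) : J6R x y = JJ (√3) (PP x y) (QQ x y) (RR x y) := by
  have e1 : (x : ℂ) + (y : ℂ) * Complex.I = ⟨x, y⟩ := by
    apply Complex.ext <;> simp
  have e2 : (x : ℂ) - (y : ℂ) * Complex.I = ⟨x, -y⟩ := by
    apply Complex.ext <;> simp
  have e3 : (9/2 : ℂ) = ⟨9/2, 0⟩ := by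
    apply Complex.ext <;> norm_num
  rw [J6R, j6, e1, e2, e3, bC_eq]
  simp only [pow_succ, pow_zero, one_mul, Complex.sub_re, Complex.add_re, Complex.mul_re, Complex.mul_im,
    Complex.sub_im, Complex.add_im, Complex.re_ofNat, Complex.im_ofNat]
  unfold JJ PP QQ RR
  ring

set_option maxHeartbeats 1000000

lemma keyM (p q r : ℝ) (h4 : p^2+3*q^2=r^3)
  (h1 : (r-2)*p+3*(r-4)*q = 3*r^2-8*r)
  (h3 : -4*p-24*q-(p^2-3*q^2)-6*p*q+6*r*(p+3*q)+12*r-9*r^2=0)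
  (h2 : p*(-8+2*q-2*p+6*r) - q*(-4-2*p-6*q+6*r)=0) : r*(r-1)*(r-4)=0 := by
  grind

lemma keyZ (p q r : ℝ) (h4 : p^2+3*q^2=r^3)
  (h1 : (r-2)*p+3*(r-4)*q = 3*r^2-8*r+1)
  (h3 : -1-4*p-24*q-(p^2-3*q^2)-6*p*q+6*r*(p+3*q)+12*r-9*r^2=0)
  (h2 : p*(-8+2*q-2*p+6*r) - q*(-4-2*p-6*q+6*r)=0) : (r-1)*(r^2-4*r+1)*(r^2-8*r+13)=0 := by
  grind

lemma keyM2 (p q r : ℝ) (h4 : p^2+3*q^2=r^3)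
  (h1 : (r-2)*p+3*(r-4)*q = 3*r^2-8*r)
  (h3 : -4*p-24*q-(p^2-3*q^2)-6*p*q+6*r*(p+3*q)+12*r-9*r^2=0)
  (h2 : p*(-8+2*q-2*p+6*r) - q*(-4-2*p-6*q+6*r)=0) (h0 : r*(r-1)*(r-4)=0) :
   (r = 0 ∧ p=0 ∧ q=0) ∨ (r = 1 ∧ p = 1/2 ∧ q = 1/2) ∨ (r = 4 ∧ p = 8 ∧ q = 0) := by
  rcases mul_eq_zero.1 h0 with h0 | h0
  · rcases mul_eq_zero.1 h0 with h0 | h0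
    · left; refine ⟨h0, ?_, ?_⟩ <;> nlinarith
    · right; left; 
      obtain rfl : r = 1 := by linarith
      refine ⟨rfl, ?_, ?_⟩ <;> grind
  · right; right
    obtain rfl : r = 4 := by linarith
    refine ⟨rfl, ?_, ?_⟩ <;> grind

lemma keyZ2 (p q r s : ℝ) (hs : s^2=3) (h4 : p^2+3*q^2=r^3)
  (h1 : (r-2)*p+3*(r-4)*q = 3*r^2-8*r+1)
  (h3 : -1-4*p-24*q-(p^2-3*q^2)-6*p*q+6*r*(p+3*q)+12*r-9*r^2=0)
  (h2 : p*(-8+2*q-2*p+6*r) - q*(-4-2*p-6*q+6*r)=0) (h0 : (r-1)*(r^2-4*r+1)*(r^2-8*r+13)=0) :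
   (r = 1 ∧ p=-1/2 ∧ s*q=s/2) ∨ (r = 2-s ∧ p = (7-4*s)/2 ∧ s*q = (2-s)/2) ∨ (r = 2+s ∧ p = (7+4*s)/2 ∧ s*q = -(2+s)/2)
   ∨ (r = 4-s ∧ p = (17-6*s)/2 ∧ s*q = s/2) ∨ (r = 4+s ∧ p = (17+6*s)/2 ∧ s*q = s/2) := by
  have h0' : (r-1)*((r-(2-s))*(r-(2+s)))*((r-(4-s))*(r-(4+s)))=0 := by
    rw [← h0]; grind
  simp only [mul_eq_zero, sub_eq_zero] at h0'
  rcases h0' with (h | h | h) | h | h <;> subst h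
  · left; refine ⟨rfl, ?_, ?_⟩ <;> grind
  · right; left; refine ⟨rfl, ?_, ?_⟩ <;> grind
  · right; right; left; refine ⟨rfl, ?_, ?_⟩ <;> grind
  · right; right; right; left; refine ⟨rfl, ?_, ?_⟩ <;> grind
  · right; right; right; right; refine ⟨rfl, ?_, ?_⟩ <;> grind

/-- critical points of value `0`, in invariants -/
def Zd (s p q r : ℝ) : Prop :=
  (r = 1 ∧ p = -1/2 ∧ q = s/2) ∨ (r = 2-s ∧ p = (7-4*s)/2 ∧ q = (2-s)/2) ∨
  (r = 2+s ∧ p = (7+4*s)/2 ∧ q = -(2+s)/2)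
   ∨ (r = 4-s ∧ p = (17-6*s)/2 ∧ q = s/2) ∨ (r = 4+s ∧ p = (17+6*s)/2 ∧ q = s/2)
/-- critical points of value `-1` other than the origin, in invariants -/
def Md (s p q r : ℝ) : Prop :=
  (r = 1 ∧ p = 1/2 ∧ q = s/2) ∨ (r = 4 ∧ p = 8 ∧ q = 0)

def EE1 (s p q r : ℝ) : ℝ := 3*p*Jp s p q r + 3*q*Jq s p q r + 2*r*Jr s p q r
def EE2 (s p q r : ℝ) : ℝ := p*Jq s p q r - q*Jp s p q r

lemma Zd_of (s p q r : ℝ) (hs : s^2 = 3) (h4 : p^2+q^2 = r^3) (h : JJ s p q r = 0)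
    (h1 : EE1 s p q r = 0) (h2 : EE2 s p q r = 0) : Zd s p q r := by
  have hs0 : s ≠ 0 := by rintro rfl; norm_num at hs
  obtain ⟨q, rfl⟩ : ∃ q', q = s*q' := ⟨q/s, by field_simp⟩
  unfold EE1 Jp Jq Jr at h1
  unfold EE2 Jp Jq at h2
  unfold JJ at h
  have g4 : p^2+3*q^2=r^3 := by rw [← h4, ← hs]; ring
  have g3 : -1-4*p-24*q-(p^2-3*q^2)-6*p*q+6*r*(p+3*q)+12*r-9*r^2=0 := by
    rw [← h, ← hs]; grind
  have g2 : p*(-8+2*q-2*p+6*r) - q*(-4-2*p-6*q+6*r)=0 := by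
    apply mul_left_cancel₀ hs0
    rw [mul_zero, ← h2]; grind
  have g1 : (r-2)*p+3*(r-4)*q = 3*r^2-8*r+1 := by grind
  exact keyZ2 p q r s hs g4 g1 g3 g2 (keyZ p q r g4 g1 g3 g2)

lemma Md_of (s p q r : ℝ) (hs : s^2 = 3) (h4 : p^2+q^2 = r^3) (h : JJ s p q r = -1)
    (h1 : EE1 s p q r = 0) (h2 : EE2 s p q r = 0) : r = 0 ∨ Md s p q r := by
  have hs0 : s ≠ 0 := by rintro rfl; norm_num at hs
  obtain ⟨q, rfl⟩ : ∃ q', q = s*q' := ⟨q/s, by field_simp⟩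
  unfold EE1 Jp Jq Jr at h1
  unfold EE2 Jp Jq at h2
  unfold JJ at h
  have g4 : p^2+3*q^2=r^3 := by rw [← h4, ← hs]; ring
  have g3 : -4*p-24*q-(p^2-3*q^2)-6*p*q+6*r*(p+3*q)+12*r-9*r^2=0 := by
    grind
  have g2 : p*(-8+2*q-2*p+6*r) - q*(-4-2*p-6*q+6*r)=0 := by
    apply mul_left_cancel₀ hs0
    rw [mul_zero, ← h2]; grind
  have g1 : (r-2)*p+3*(r-4)*q = 3*r^2-8*r := by grind
  rcases keyM2 p q r g4 g1 g3 g2 (keyM p q r g4 g1 g3 g2) with h | h | h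
  · exact Or.inl h.1
  · exact Or.inr (Or.inl ⟨h.1, h.2.1, by rw [h.2.2]; ring⟩)
  · exact Or.inr (Or.inr ⟨h.1, h.2.1, by rw [h.2.2]; ring⟩)

lemma Zd_crit (s p q r : ℝ) (hs : s^2 = 3) (h : Zd s p q r) :
    JJ s p q r = 0 ∧ EE1 s p q r = 0 ∧ EE2 s p q r = 0 := by
  unfold JJ EE1 EE2 Jp Jq Jr
  rcases h with ⟨rfl, rfl, rfl⟩ | ⟨rfl, rfl, rfl⟩ | ⟨rfl, rfl, rfl⟩ | ⟨rfl, rfl, rfl⟩ | ⟨rfl, rfl, rfl⟩ <;>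
  refine ⟨?_, ?_, ?_⟩ <;> grind

lemma Md_crit (s p q r : ℝ) (hs : s^2 = 3) (h : Md s p q r) :
    JJ s p q r = -1 ∧ EE1 s p q r = 0 ∧ EE2 s p q r = 0 := by
  unfold JJ EE1 EE2 Jp Jq Jr
  rcases h with ⟨rfl, rfl, rfl⟩ | ⟨rfl, rfl, rfl⟩ <;>
  refine ⟨?_, ?_, ?_⟩ <;> grind

/-- `|u|⁴` times the Hessian determinant, in invariants -/
def HD (s p q r : ℝ) : ℝ := 4*(r^2*(12+24*(p+s*q)-36*r)^2
  - (6*(-2*p-4*s*q)-30*((p^2-q^2)/2+s*p*q)+36*r*(p+s*q)-18*r^2)^2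
  - (6*(-2*q+4*s*p)-30*(p*q-s*(p^2-q^2)/2)+36*r*(q-s*p))^2)

lemma HD_eq (s x y : ℝ) : (RR x y)^2 * (Jxx s x y * Jyy s x y - Jxy s x y ^ 2)
    = HD s (PP x y) (QQ x y) (RR x y) := by
  simp only [HD, Jxx, Jyy, Jxy, Jdd, Jd, Jp, Jq, Jr, PP, QQ, RR]
  ring

lemma Zd_HD (s p q r : ℝ) (hs : s^2 = 3) (h1 : 1.73 < s) (h2 : s < 1.733) (h : Zd s p q r) :
    HD s p q r ≠ 0 := by
  unfold HD
  rcases h with ⟨rfl, rfl, rfl⟩ | ⟨rfl, rfl, rfl⟩ | ⟨rfl, rfl, rfl⟩ | ⟨rfl, rfl, rfl⟩ | ⟨rfl, rfl, rfl⟩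
  · refine ne_of_eq_of_ne (b := -5184) (by grind) (by norm_num)
  · refine ne_of_eq_of_ne (b := -89856+51840*s) (by grind) (by intro h; linarith)
  · refine ne_of_eq_of_ne (b := -89856-51840*s) (by grind) (by intro h; linarith)
  · refine ne_of_eq_of_ne (b := -642816+362880*s) (by grind) (by intro h; nlinarith)
  · refine ne_of_eq_of_ne (b := -642816-362880*s) (by grind) (by intro h; linarith)

lemma Md_HD (s p q r : ℝ) (hs : s^2 = 3) (h : Md s p q r) :
    HD s p q r ≠ 0 := by
  unfold HD
  rcases h with ⟨rfl, rfl, rfl⟩ | ⟨rfl, rfl, rfl⟩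
  · refine ne_of_eq_of_ne (b := 1296) (by grind) (by norm_num)
  · refine ne_of_eq_of_ne (b := 82944) (by grind) (by norm_num)

lemma PQR (x y : ℝ) : (PP x y)^2 + (QQ x y)^2 = (RR x y)^3 := by
  unfold PP QQ RR; ring

lemma EE1_eq (s x y : ℝ) : EE1 s (PP x y) (QQ x y) (RR x y) = x * Jx s x y + y * Jy s x y := by
  simp only [EE1, Jx, Jy, Jd, Jp, Jq, Jr, PP, QQ, RR]; ring
lemma EE2_eq (s x y : ℝ) : 3*EE2 s (PP x y) (QQ x y) (RR x y) = x * Jy s x y - y * Jx s x y := by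
  simp only [EE2, Jx, Jy, Jd, Jp, Jq, Jr, PP, QQ, RR]; ring

lemma grad_iff (s x y : ℝ) (h : RR x y ≠ 0) : (Jx s x y = 0 ∧ Jy s x y = 0) ↔
    (EE1 s (PP x y) (QQ x y) (RR x y) = 0 ∧ EE2 s (PP x y) (QQ x y) (RR x y) = 0) := by
  have e1 := EE1_eq s x y
  have e2 := EE2_eq s x y
  constructor
  · rintro ⟨h1, h2⟩
    rw [h1, h2] at e1 e2
    exact ⟨by linarith, by linarith⟩
  · rintro ⟨h1, h2⟩
    rw [h1] at e1; rw [h2] at e2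
    constructor <;> apply mul_left_cancel₀ h <;> unfold RR
    · linear_combination y * e2 - x * e1
    · linear_combination - x * e2 - y * e1

lemma RR_eq_zero (x y : ℝ) : RR x y = 0 ↔ x = 0 ∧ y = 0 := by
  unfold RR
  constructor
  · intro h
    exact ⟨by nlinarith, by nlinarith⟩
  · rintro ⟨rfl, rfl⟩; norm_num

lemma critZ (s x y : ℝ) (hs : s^2 = 3) (h1 : 1.73 < s) (h2 : s < 1.733) :
    (JJ s (PP x y) (QQ x y) (RR x y) = 0 ∧ Jx s x y = 0 ∧ Jy s x y = 0) ↔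
      Zd s (PP x y) (QQ x y) (RR x y) := by
  constructor
  · rintro ⟨h, hg⟩
    have hr : RR x y ≠ 0 := by
      intro h0
      obtain ⟨rfl, rfl⟩ := (RR_eq_zero x y).1 h0
      norm_num [JJ, PP, QQ, RR] at h
    rw [grad_iff s x y hr] at hg
    exact Zd_of _ _ _ _ hs (PQR x y) h hg.1 hg.2
  · intro h
    have hr : RR x y ≠ 0 := by
      rcases h with h | h | h | h | h <;> rw [h.1] <;> intro h0 <;> linarith
    rw [grad_iff s x y hr]
    exact Zd_crit _ _ _ _ hs h

lemma critM (s x y : ℝ) (hs : s^2 = 3) :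
    (JJ s (PP x y) (QQ x y) (RR x y) = -1 ∧ Jx s x y = 0 ∧ Jy s x y = 0) ↔
      (x = 0 ∧ y = 0) ∨ Md s (PP x y) (QQ x y) (RR x y) := by
  by_cases hr : RR x y = 0
  · obtain ⟨rfl, rfl⟩ := (RR_eq_zero x y).1 hr
    norm_num [JJ, PP, QQ, RR, Jx, Jy, Jd]
  · rw [grad_iff s x y hr, ← RR_eq_zero x y]
    constructor
    · rintro ⟨h, hg⟩
      exact Md_of _ _ _ _ hs (PQR x y) h hg.1 hg.2
    · rintro (h | h)
      · exact absurd h hr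
      · exact Md_crit _ _ _ _ hs h

lemma ndZ (s x y : ℝ) (hs : s^2 = 3) (h1 : 1.73 < s) (h2 : s < 1.733)
    (h : Zd s (PP x y) (QQ x y) (RR x y)) : Jxx s x y * Jyy s x y - Jxy s x y ^ 2 ≠ 0 := by
  intro h0
  apply Zd_HD _ _ _ _ hs h1 h2 h
  rw [← HD_eq, h0, mul_zero]

lemma ndM (s x y : ℝ) (hs : s^2 = 3)
    (h : (x = 0 ∧ y = 0) ∨ Md s (PP x y) (QQ x y) (RR x y)) :
    Jxx s x y * Jyy s x y - Jxy s x y ^ 2 ≠ 0 := by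
  rcases h with ⟨rfl, rfl⟩ | h
  · norm_num [Jxx, Jyy, Jxy, Jdd, Jd, Jp, Jq, Jr, PP, QQ, RR]
  · intro h0
    apply Md_HD _ _ _ _ hs h
    rw [← HD_eq, h0, mul_zero]

/-! ### Counting -/

def UU (p : Fin 3 → ℝ) : ℂ := ⟨p 0, p 1⟩

lemma UU3 (p : Fin 3 → ℝ) : UU p ^ 3 = ⟨PP (p 0) (p 1), QQ (p 0) (p 1)⟩ := by
  apply Complex.ext <;> simp [UU, pow_succ, PP, QQ] <;> ring

lemma fibre (A : ℂ) (hA : A ≠ 0) (z : ℝ) :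
    {p : Fin 3 → ℝ | UU p ^ 3 = A ∧ p 2 = z}.Finite ∧
    {p : Fin 3 → ℝ | UU p ^ 3 = A ∧ p 2 = z}.ncard = 3 := by
  classical
  have hprim := Complex.isPrimitiveRoot_exp 3 (by norm_num)
  let T : Finset ℂ := (Polynomial.nthRoots 3 A).toFinset
  have hT : T.card = 3 := by
    have hnd : (Polynomial.nthRoots 3 A).Nodup := hprim.nthRoots_nodup hA
    rw [Multiset.toFinset_card_of_nodup hnd, hprim.card_nthRoots, if_pos]
    obtain ⟨a, ha⟩ := IsAlgClosed.exists_pow_nat_eq A (n := 3) (by norm_num)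
    exact ⟨a, ha⟩
  let φ : ℂ → (Fin 3 → ℝ) := fun u => ![u.re, u.im, z]
  have hφ : Function.Injective φ := by
    intro u v h
    have h0 := congrFun h 0
    have h1 := congrFun h 1
    exact Complex.ext (by simpa [φ] using h0) (by simpa [φ] using h1)
  have hset : {p : Fin 3 → ℝ | UU p ^ 3 = A ∧ p 2 = z} = ((T.image φ : Finset _) : Set _) := by
    ext p
    simp only [Set.mem_setOf_eq, Finset.coe_image, Set.mem_image, Finset.mem_coe, T,
      Multiset.mem_toFinset, Polynomial.mem_nthRoots (show 0 < 3 by norm_num)]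
    constructor
    · rintro ⟨h1, h2⟩
      refine ⟨UU p, h1, ?_⟩
      ext i; fin_cases i <;> simp [φ, UU, h2]
    · rintro ⟨u, hu, rfl⟩
      exact ⟨by simpa [UU, φ] using hu, by simp [φ]⟩
  rw [hset]
  refine ⟨Finset.finite_toSet _, ?_⟩
  rw [Set.ncard_coe_finset, Finset.card_image_of_injective _ hφ, hT]

lemma fibres (z : ℝ) (T : Finset ℂ) (hT : (0 : ℂ) ∉ T) :
    {p : Fin 3 → ℝ | UU p ^ 3 ∈ T ∧ p 2 = z}.Finite ∧
    {p : Fin 3 → ℝ | UU p ^ 3 ∈ T ∧ p 2 = z}.ncard = 3 * T.card := by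
  classical
  induction T using Finset.induction_on with
  | empty => simp
  | insert a T ha ih =>
    have ih := ih (fun h => hT (Finset.mem_insert_of_mem h))
    have h1 := fibre a (by rintro rfl; exact hT (Finset.mem_insert_self _ _)) z
    have hset : {p : Fin 3 → ℝ | UU p ^ 3 ∈ insert a T ∧ p 2 = z} =
      {p : Fin 3 → ℝ | UU p ^ 3 = a ∧ p 2 = z} ∪ {p : Fin 3 → ℝ | UU p ^ 3 ∈ T ∧ p 2 = z} := by
      ext p; simp only [Finset.mem_insert, Set.mem_setOf_eq, Set.mem_union]; tauto
    rw [hset]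
    refine ⟨h1.1.union ih.1, ?_⟩
    rw [Set.ncard_union_eq _ h1.1 ih.1, h1.2, ih.2, Finset.card_insert_of_notMem ha]
    · ring
    · rw [Set.disjoint_left]
      rintro p ⟨h2, -⟩ ⟨h3, -⟩
      exact ha (h2 ▸ h3)

def TZ (s : ℝ) : Finset ℂ :=
  {⟨-1/2, s/2⟩, ⟨(7-4*s)/2, (2-s)/2⟩, ⟨(7+4*s)/2, -(2+s)/2⟩, ⟨(17-6*s)/2, s/2⟩, ⟨(17+6*s)/2, s/2⟩}
def TM (s : ℝ) : Finset ℂ := {⟨1/2, s/2⟩, ⟨8, 0⟩}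

lemma cube_inj {a b : ℝ} (h : a^3 = b^3) : a = b :=
  (Odd.strictMono_pow (show Odd 3 by decide)).injective h

lemma mem_TZ (s : ℝ) (hs : s^2 = 3) (p : Fin 3 → ℝ) :
    UU p ^ 3 ∈ TZ s ↔ Zd s (PP (p 0) (p 1)) (QQ (p 0) (p 1)) (RR (p 0) (p 1)) := by
  have h := PQR (p 0) (p 1)
  rw [UU3]
  simp only [TZ, Finset.mem_insert, Finset.mem_singleton, Complex.mk.injEq, Zd]
  generalize PP (p 0) (p 1) = P at *
  generalize QQ (p 0) (p 1) = Q at *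
  generalize RR (p 0) (p 1) = R at *
  constructor
  · rintro (⟨rfl, rfl⟩ | ⟨rfl, rfl⟩ | ⟨rfl, rfl⟩ | ⟨rfl, rfl⟩ | ⟨rfl, rfl⟩)
    · exact Or.inl ⟨cube_inj (by grind), rfl, rfl⟩
    · exact Or.inr (Or.inl ⟨cube_inj (by grind), rfl, rfl⟩)
    · exact Or.inr (Or.inr (Or.inl ⟨cube_inj (by grind), rfl, rfl⟩))
    · exact Or.inr (Or.inr (Or.inr (Or.inl ⟨cube_inj (by grind), rfl, rfl⟩)))
    · exact Or.inr (Or.inr (Or.inr (Or.inr ⟨cube_inj (by grind), rfl, rfl⟩)))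
  · tauto

lemma mem_TM (s : ℝ) (hs : s^2 = 3) (p : Fin 3 → ℝ) :
    UU p ^ 3 ∈ TM s ↔ Md s (PP (p 0) (p 1)) (QQ (p 0) (p 1)) (RR (p 0) (p 1)) := by
  have h := PQR (p 0) (p 1)
  rw [UU3]
  simp only [TM, Finset.mem_insert, Finset.mem_singleton, Complex.mk.injEq, Md]
  generalize PP (p 0) (p 1) = P at *
  generalize QQ (p 0) (p 1) = Q at *
  generalize RR (p 0) (p 1) = R at *
  constructor
  · rintro (⟨rfl, rfl⟩ | ⟨rfl, rfl⟩)
    · exact Or.inl ⟨cube_inj (by grind), rfl, rfl⟩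
    · exact Or.inr ⟨cube_inj (by grind), rfl, rfl⟩
  · tauto

lemma card_TZ (s : ℝ) (h1 : 1.73 < s) (h2 : s < 1.733) : (TZ s).card = 5 ∧ (0 : ℂ) ∉ TZ s := by
  constructor
  · unfold TZ
    rw [Finset.card_insert_of_notMem, Finset.card_insert_of_notMem, Finset.card_insert_of_notMem,
      Finset.card_insert_of_notMem, Finset.card_singleton]
    all_goals
      simp only [Finset.mem_insert, Finset.mem_singleton, Complex.mk.injEq, not_or, not_and]
      repeat' constructor
    all_goals
      intro h3 h4
      linarith
  · simp only [TZ, Finset.mem_insert, Finset.mem_singleton, Complex.ext_iff, not_or, not_and,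
      Complex.zero_re, Complex.zero_im]
    refine ⟨?_, ?_, ?_, ?_, ?_⟩ <;> intro h3 h4 <;> linarith

lemma card_TM (s : ℝ) (h1 : 1.73 < s) : (TM s).card = 2 ∧ (0 : ℂ) ∉ TM s := by
  constructor
  · unfold TM
    rw [Finset.card_insert_of_notMem, Finset.card_singleton]
    simp only [Finset.mem_singleton, Complex.mk.injEq, not_and]
    intro h3 h4
    linarith
  · simp only [TM, Finset.mem_insert, Finset.mem_singleton, Complex.ext_iff, not_or, not_and,
      Complex.zero_re, Complex.zero_im]
    refine ⟨?_, ?_⟩ <;> intro h3 h4 <;> linarith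

lemma gz_eq_zero (z : ℝ) : gz z = 0 ↔ z = 0 ∨ z = 1 ∨ z = 3 := by
  unfold gz
  constructor
  · intro h
    have : (z-3)^3*z*(6*z-6) = 0 := by linarith
    rcases mul_eq_zero.1 this with h | h
    · rcases mul_eq_zero.1 h with h | h
      · have := pow_eq_zero_iff (n := 3) (by norm_num) |>.1 h
        right; right; linarith
      · exact Or.inl h
    · right; left; linarith
  · rintro (rfl | rfl | rfl) <;> norm_num

lemma sing_iff (s : ℝ) (hs : s^2 = 3) (h1 : 1.73 < s) (h2 : s < 1.733) (p : Fin 3 → ℝ) :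
    (FF s p = 0 ∧ ∀ i, pd i (FF s) p = 0) ↔
      ((UU p ^ 3 ∈ TZ s ∧ p 2 = 0) ∨ (UU p ^ 3 ∈ TZ s ∧ p 2 = 3)) ∨
      ((UU p ^ 3 ∈ TM s ∧ p 2 = 1) ∨ p = ![0, 0, 1]) := by
  have hp : p = ![0, 0, 1] ↔ (p 0 = 0 ∧ p 1 = 0) ∧ p 2 = 1 := by
    constructor
    · rintro rfl; simp
    · rintro ⟨⟨h0, h1⟩, h2⟩
      ext i; fin_cases i <;> simp [*]
  rw [mem_TZ s hs, mem_TM s hs, hp, ← critZ s _ _ hs h1 h2, ← or_and_right, or_comm (a := Md _ _ _ _),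
    ← critM s _ _ hs]
  have hall : (∀ i, pd i (FF s) p = 0) ↔
      (pd 0 (FF s) p = 0 ∧ pd 1 (FF s) p = 0 ∧ pd 2 (FF s) p = 0) := by
    constructor
    · intro h; exact ⟨h 0, h 1, h 2⟩
    · rintro ⟨h0, h1, h2⟩ i
      fin_cases i
      · exact h0
      · exact h1
      · exact h2
  rw [hall]
  simp only [pd0, pd1, pd2, gz_eq_zero, FF]
  have g0 : gg 0 = 0 := by norm_num [gg]
  have g1 : gg 1 = 1 := by norm_num [gg]
  have g3 : gg 3 = 0 := by norm_num [gg]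
  constructor
  · rintro ⟨h, hx, hy, hz | hz | hz⟩ <;> rw [hz] at h ⊢
    · left; left; exact ⟨⟨by linarith, hx, hy⟩, rfl⟩
    · right; exact ⟨⟨by linarith, hx, hy⟩, rfl⟩
    · left; right; exact ⟨⟨by linarith, hx, hy⟩, rfl⟩
  · rintro ((⟨⟨h, hx, hy⟩, hz⟩ | ⟨⟨h, hx, hy⟩, hz⟩) | ⟨⟨h, hx, hy⟩, hz⟩) <;>
    rw [h, hz]
    · exact ⟨by linarith, hx, hy, Or.inl rfl⟩
    · exact ⟨by linarith, hx, hy, Or.inr (Or.inr rfl)⟩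
    · exact ⟨by linarith, hx, hy, Or.inr (Or.inl rfl)⟩

lemma hess_A3 (s : ℝ) (hs : s^2 = 3) (h1 : 1.73 < s) (h2 : s < 1.733) (p : Fin 3 → ℝ)
    (h : UU p ^ 3 ∈ TZ s ∧ p 2 = 3) :
    (hessian (FF s) p).det = 0 ∧ (hessian (FF s) p).rank = 2 := by
  have hd := ndZ s _ _ hs h1 h2 ((mem_TZ s hs p).1 h.1)
  have hg : gzz (p 2) = 0 := by rw [h.2]; norm_num [gzz]
  rw [hess, hg]
  exact ⟨by rw [det_hess, mul_zero], rank_hess _ _ _ hd⟩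

lemma rank_of_det (M : Matrix (Fin 3) (Fin 3) ℝ) (h : M.det ≠ 0) : M.rank ≠ 2 := by
  have : IsUnit M := by
    rw [Matrix.isUnit_iff_isUnit_det, isUnit_iff_ne_zero]; exact h
  rw [Matrix.rank_of_isUnit _ this]; simp

lemma hess_A1 (s : ℝ) (hs : s^2 = 3) (h1 : 1.73 < s) (h2 : s < 1.733) (p : Fin 3 → ℝ)
    (h : (UU p ^ 3 ∈ TZ s ∧ p 2 = 0) ∨ ((UU p ^ 3 ∈ TM s ∧ p 2 = 1) ∨ p = ![0, 0, 1])) :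
    (hessian (FF s) p).det ≠ 0 ∧ (hessian (FF s) p).rank ≠ 2 := by
  have key : (hessian (FF s) p).det ≠ 0 := by
    rw [hess, det_hess]
    rcases h with h | h | h
    · refine mul_ne_zero (ndZ s _ _ hs h1 h2 ((mem_TZ s hs p).1 h.1)) ?_
      rw [h.2]; norm_num [gzz]
    · refine mul_ne_zero (ndM s _ _ hs (Or.inr ((mem_TM s hs p).1 h.1))) ?_
      rw [h.2]; norm_num [gzz]
    · refine mul_ne_zero (ndM s _ _ hs (Or.inl (by simp [h]))) ?_
      have : p 2 = 1 := by rw [h]; rfl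
      rw [this]; norm_num [gzz]
  exact ⟨key, rank_of_det _ key⟩

/-- The sextic surface `J₆(x,y) + (z-3)⁴z²/16 = 0` has exactly 37 real singular points:
22 with invertible Hessian (nodes, `A₁`) and 15 where the Hessian has rank 2 (`A₃`). -/
theorem stmt11 (f : (Fin 3 → ℝ) → ℝ)
    (hf : ∀ p, f p = J6R (p 0) (p 1) + (p 2 - 3) ^ 4 * (p 2) ^ 2 / 16) :
    {p : Fin 3 → ℝ | f p = 0 ∧ ∀ i, pd i f p = 0}.Finite ∧
    {p : Fin 3 → ℝ | f p = 0 ∧ ∀ i, pd i f p = 0}.ncard = 37 ∧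
    {p : Fin 3 → ℝ | (f p = 0 ∧ ∀ i, pd i f p = 0) ∧ (hessian f p).det ≠ 0}.ncard = 22 ∧
    {p : Fin 3 → ℝ | (f p = 0 ∧ ∀ i, pd i f p = 0) ∧ (hessian f p).rank = 2}.ncard = 15 := by
  obtain ⟨s, hsdef⟩ : ∃ s : ℝ, s = √3 := ⟨_, rfl⟩
  have hs : s^2 = 3 := by rw [hsdef]; norm_num
  have hs0 : 0 ≤ s := by rw [hsdef]; positivity
  have h1 : 1.73 < s := by norm_num; nlinarith
  have h2 : s < 1.733 := by norm_num; nlinarith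
  obtain rfl : f = FF s := by
    funext p
    rw [hf, J6R_eq, FF, gg, hsdef]
  clear hf hsdef
  let S0 : Set (Fin 3 → ℝ) := {p | UU p ^ 3 ∈ TZ s ∧ p 2 = 0}
  let S3 : Set (Fin 3 → ℝ) := {p | UU p ^ 3 ∈ TZ s ∧ p 2 = 3}
  let S1 : Set (Fin 3 → ℝ) := {p | UU p ^ 3 ∈ TM s ∧ p 2 = 1}
  let So : Set (Fin 3 → ℝ) := {![0, 0, 1]}
  obtain ⟨f0, n0⟩ : S0.Finite ∧ S0.ncard = 3 * (TZ s).card := fibres 0 _ (card_TZ s h1 h2).2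
  obtain ⟨f3, n3⟩ : S3.Finite ∧ S3.ncard = 3 * (TZ s).card := fibres 3 _ (card_TZ s h1 h2).2
  obtain ⟨f1, n1⟩ : S1.Finite ∧ S1.ncard = 3 * (TM s).card := fibres 1 _ (card_TM s h1).2
  rw [(card_TZ s h1 h2).1] at n0 n3
  rw [(card_TM s h1).1] at n1
  have fo : So.Finite := Set.finite_singleton _
  have no : So.ncard = 1 := Set.ncard_singleton _
  have d1o : Disjoint S1 So := by
    rw [Set.disjoint_left]
    rintro p ⟨hp, -⟩ hq
    obtain rfl : p = ![0, 0, 1] := hq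
    apply (card_TM s h1).2
    have : UU ![0, 0, 1] ^ 3 = 0 := by
      rw [UU3]; apply Complex.ext <;> simp [PP, QQ]
    rwa [this] at hp
  have z0 : ∀ p ∈ S0, p 2 = 0 := fun p hp => hp.2
  have z3 : ∀ p ∈ S3, p 2 = 3 := fun p hp => hp.2
  have z1 : ∀ p ∈ S1 ∪ So, p 2 = 1 := by
    rintro p (hp | hp)
    · exact hp.2
    · obtain rfl : p = ![0, 0, 1] := hp
      simp
  have d01 : Disjoint S0 (S1 ∪ So) := by
    rw [Set.disjoint_left]
    intro p h h'
    have e1 := z0 p h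
    have e2 := z1 p h'
    linarith
  have dA : Disjoint (S0 ∪ (S1 ∪ So)) S3 := by
    rw [Set.disjoint_left]
    rintro p (h | h) h'
    · have e1 := z0 p h
      have e2 := z3 p h'
      linarith
    · have e1 := z1 p h
      have e2 := z3 p h'
      linarith
  have n22 : (S0 ∪ (S1 ∪ So)).ncard = 22 := by
    rw [Set.ncard_union_eq d01 f0 (f1.union fo), Set.ncard_union_eq d1o f1 fo, n0, n1, no]
  have e37 : {p : Fin 3 → ℝ | FF s p = 0 ∧ ∀ i, pd i (FF s) p = 0} = (S0 ∪ (S1 ∪ So)) ∪ S3 := by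
    ext p
    rw [Set.mem_setOf_eq, sing_iff s hs h1 h2]
    show ((p ∈ S0 ∨ p ∈ S3) ∨ (p ∈ S1 ∨ p ∈ So)) ↔ ((p ∈ S0 ∨ (p ∈ S1 ∨ p ∈ So)) ∨ p ∈ S3)
    tauto
  have mem37 : ∀ p, (FF s p = 0 ∧ ∀ i, pd i (FF s) p = 0) ↔ p ∈ (S0 ∪ (S1 ∪ So)) ∪ S3 :=
    fun p => Set.ext_iff.1 e37 p
  have hA1 : ∀ p ∈ S0 ∪ (S1 ∪ So), (hessian (FF s) p).det ≠ 0 ∧ (hessian (FF s) p).rank ≠ 2 :=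
    fun p hp => hess_A1 s hs h1 h2 p hp
  have hA3 : ∀ p ∈ S3, (hessian (FF s) p).det = 0 ∧ (hessian (FF s) p).rank = 2 :=
    fun p hp => hess_A3 s hs h1 h2 p hp
  refine ⟨?_, ?_, ?_, ?_⟩
  · rw [e37]; exact (f0.union (f1.union fo)).union f3
  · rw [e37, Set.ncard_union_eq dA (f0.union (f1.union fo)) f3, n22, n3]
  · rw [← n22]
    congr 1
    ext p
    rw [Set.mem_setOf_eq, mem37]
    constructor
    · rintro ⟨h | h, hd⟩
      · exact h
      · exact absurd (hA3 p h).1 hd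
    · intro h
      exact ⟨Or.inl h, (hA1 p h).1⟩
  · rw [show 15 = S3.ncard from n3.symm]
    congr 1
    ext p
    rw [Set.mem_setOf_eq, mem37]
    constructor
    · rintro ⟨h | h, hd⟩
      · exact absurd hd (hA1 p h).2
      · exact h
    · intro h
      exact ⟨Or.inr h, (hA3 p h).2⟩
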